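/- arXiv:1911.03820 — 2 statements merged into one kernel-verified Lean document; each statement's English description precedes it below -/
import Mathlib

section
/- Let f be a holomorphic modular function for SL(2,ℤ). Let V_0, V_1 be even words and W_1 a non-empty even word, and set w_1 := [\overline{W_1}]. Then lim_{n→∞} f([\overline{V_0 W_1^n V_1}]) = f(w_1). -/
open Matrix Filter Topology

noncomputable section

/-- The matrix `[[k,1],[1,0]]` of a single partial quotient. -/
def cfMat (k : ℕ+) : Matrix (Fin 2) (Fin 2) ℤ := !![(k : ℤ), 1; 1, 0]

/-- `γ_W` for a word `W = (k_1, …, k_r)` of positive integers. -/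
def gammaWord (W : List ℕ+) : Matrix (Fin 2) (Fin 2) ℤ := (W.map cfMat).prod

/-- `W^n`, the `n`-fold concatenation of the word `W`. -/
def wordPow (W : List ℕ+) (n : ℕ) : List ℕ+ := (List.replicate n W).flatten

/-- `N(W)`: the largest `n` such that `W = V^n` for some word `V`. -/
def wordN (W : List ℕ+) : ℕ := sSup {n : ℕ | ∃ V : List ℕ+, W = wordPow V n}

/-- Möbius action of an integer matrix on `ℝ`. -/
def actR (M : Matrix (Fin 2) (Fin 2) ℤ) (x : ℝ) : ℝ :=
  ((M 0 0 : ℝ) * x + (M 0 1 : ℝ)) / ((M 1 0 : ℝ) * x + (M 1 1 : ℝ))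

/-- Möbius action of an integer matrix on `ℂ`. -/
def actC (M : Matrix (Fin 2) (Fin 2) ℤ) (z : ℂ) : ℂ :=
  ((M 0 0 : ℤ) * z + (M 0 1 : ℤ)) / ((M 1 0 : ℤ) * z + (M 1 1 : ℤ))

/-- Möbius action of a real matrix on `ℝ`. -/
def actRR (M : Matrix (Fin 2) (Fin 2) ℝ) (x : ℝ) : ℝ :=
  (M 0 0 * x + M 0 1) / (M 1 0 * x + M 1 1)

/-- Möbius action of a real matrix on `ℂ`. -/
def actCR (M : Matrix (Fin 2) (Fin 2) ℝ) (z : ℂ) : ℂ :=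
  ((M 0 0 : ℂ) * z + (M 0 1 : ℂ)) / ((M 1 0 : ℂ) * z + (M 1 1 : ℂ))

/-- Automorphy factor `j(M, x) = c·x + d`. -/
def jFac (M : Matrix (Fin 2) (Fin 2) ℝ) (x : ℝ) : ℝ := M 1 0 * x + M 1 1

/-- `w = [\overline{W}]`: `w` is the (unique) real number `> 1` fixed by the Möbius action
of `γ_W`. -/
def IsCFValue (W : List ℕ+) (w : ℝ) : Prop := 1 < w ∧ actR (gammaWord W) w = w

/-- `w'` is the Galois conjugate of `[\overline{W}]`, i.e. the other real fixed point
of `γ_W`. -/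
def IsCFConj (W : List ℕ+) (w w' : ℝ) : Prop := w' ≠ w ∧ actR (gammaWord W) w' = w'

/-- `g = γ_w` is the fundamental automorph of `w`: it fixes `w`, has `ε_w = j(g,w) > 1`, and
the stabilizer of `w` in `SL(2,ℤ)` is exactly `{± g^n : n ∈ ℤ}`. -/
def IsFundAutomorph (w : ℝ) (g : Matrix.SpecialLinearGroup (Fin 2) ℤ) : Prop :=
  actR (g : Matrix (Fin 2) (Fin 2) ℤ) w = w ∧
  1 < (g 1 0 : ℝ) * w + (g 1 1 : ℝ) ∧
  ∀ M : Matrix.SpecialLinearGroup (Fin 2) ℤ,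
    actR (M : Matrix (Fin 2) (Fin 2) ℤ) w = w ↔
      ∃ n : ℤ,
        (M : Matrix (Fin 2) (Fin 2) ℤ) =
          ((g ^ n : Matrix.SpecialLinearGroup (Fin 2) ℤ) : Matrix (Fin 2) (Fin 2) ℤ) ∨
        (M : Matrix (Fin 2) (Fin 2) ℤ) =
          -((g ^ n : Matrix.SpecialLinearGroup (Fin 2) ℤ) : Matrix (Fin 2) (Fin 2) ℤ)

/-- Contour integral of `g` along the straight line segment from `a` to `b`. -/
def segInt (g : ℂ → ℂ) (a b : ℂ) : ℂ := (b - a) * ∫ t in (0:ℝ)..1, g (a + t * (b - a))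

/-- The integrand of the differential `η_{w', w}`. -/
def eta (w w' : ℝ) (z : ℂ) : ℂ := 1 / (z - (w' : ℂ)) - 1 / (z - (w : ℂ))

/-- `∫_{z₀}^{z₁} f η_w`: the contour integral of `f(z)·(1/(z-w') - 1/(z-w)) dz`
along the straight line segment from `z₀` to `z₁`. -/
def cycInt (f : ℂ → ℂ) (w w' : ℝ) (z0 z1 : ℂ) : ℂ := segInt (fun z => f z * eta w w' z) z0 z1

/-- A holomorphic modular function for `SL(2,ℤ)`: holomorphic on the upper half plane and
invariant under the Möbius action of `SL(2,ℤ)`. -/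
def IsModular (f : ℂ → ℂ) : Prop :=
  DifferentiableOn ℂ f {z : ℂ | 0 < z.im} ∧
  ∀ g : Matrix.SpecialLinearGroup (Fin 2) ℤ, ∀ z : ℂ, 0 < z.im →
    f (actC (g : Matrix (Fin 2) (Fin 2) ℤ) z) = f z

/-- `w` is a real quadratic irrational with Galois conjugate `w'` (the other root of the
same integral quadratic equation). -/
def IsQuadPair (w w' : ℝ) : Prop :=
  Irrational w ∧ w' ≠ w ∧ ∃ a b c : ℤ, a ≠ 0 ∧
    (a : ℝ) * w ^ 2 + (b : ℝ) * w + (c : ℝ) = 0 ∧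
    (a : ℝ) * w' ^ 2 + (b : ℝ) * w' + (c : ℝ) = 0

/-- The `i`-th term (0-indexed) of the regular continued fraction expansion of `x`:
term `0` is `⌊x⌋` and term `i+1` is the `i`-th partial denominator. -/
def cfTerm (x : ℝ) (i : ℕ) : Option ℝ :=
  match i with
  | 0 => some (GenContFract.of x).h
  | i + 1 => (GenContFract.of x).partDens.get? i

/-- `w` is a real quadratic irrational. -/
def IsQuadIrr (w : ℝ) : Prop :=
  Irrational w ∧ ∃ a b c : ℤ, a ≠ 0 ∧ (a : ℝ) * w ^ 2 + (b : ℝ) * w + (c : ℝ) = 0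

abbrev SL2Z := Matrix.SpecialLinearGroup (Fin 2) ℤ
abbrev SL2R := Matrix.SpecialLinearGroup (Fin 2) ℝ
lemma actC_eq_coe_smul (g : SL2Z) (z : UpperHalfPlane) :
    actC (g : Matrix (Fin 2) (Fin 2) ℤ) z = ((g • z : UpperHalfPlane) : ℂ) := by
  rw [UpperHalfPlane.coe_specialLinearGroup_apply]
  simp [actC]

lemma im_actC_pos (g : SL2Z) {z : ℂ} (hz : 0 < z.im) :
    0 < (actC (g : Matrix (Fin 2) (Fin 2) ℤ) z).im := by
  have := actC_eq_coe_smul g ⟨z, hz⟩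
  rw [show z = ((⟨z, hz⟩ : UpperHalfPlane) : ℂ) from rfl, this]
  exact (g • (⟨z, hz⟩ : UpperHalfPlane)).im_pos

lemma actC_mul (g h : SL2Z) {z : ℂ} (hz : 0 < z.im) :
    actC ((g * h : SL2Z) : Matrix (Fin 2) (Fin 2) ℤ) z =
      actC (g : Matrix (Fin 2) (Fin 2) ℤ) (actC (h : Matrix (Fin 2) (Fin 2) ℤ) z) := by
  have := actC_eq_coe_smul (g * h) ⟨z, hz⟩
  rw [mul_smul, ← actC_eq_coe_smul, ← actC_eq_coe_smul] at this
  exact this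

lemma actC_one (z : ℂ) : actC ((1 : SL2Z) : Matrix (Fin 2) (Fin 2) ℤ) z = z := by
  simp [actC]

lemma actC_neg (M : Matrix (Fin 2) (Fin 2) ℤ) (z : ℂ) : actC (-M) z = actC M z := by
  simp only [actC, Matrix.neg_apply, Int.cast_neg]
  rw [← neg_div_neg_eq]
  congr 1 <;> ring

lemma sub_ofReal_ne_zero {z : ℂ} (hz : 0 < z.im) (u : ℝ) : z - u ≠ 0 := by
  intro h
  have := congrArg Complex.im h
  simp at this
  linarith

lemma linear_ne_zero_of_det (g : SL2Z) {z : ℂ} (hz : 0 < z.im) :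
    ((g 1 0 : ℤ) : ℂ) * z + ((g 1 1 : ℤ) : ℂ) ≠ 0 := by
  have := UpperHalfPlane.denom_ne_zero (g : GL (Fin 2) ℝ) ⟨z, hz⟩
  simpa [UpperHalfPlane.denom] using this

lemma det_eq_one (g : SL2Z) : g 0 0 * g 1 1 - g 0 1 * g 1 0 = 1 := by
  rw [← Matrix.det_fin_two]; exact g.2

lemma hasDerivAt_actC (g : SL2Z) {z : ℂ} (hz : 0 < z.im) :
    HasDerivAt (actC (g : Matrix (Fin 2) (Fin 2) ℤ))
      (1 / (((g 1 0 : ℤ) : ℂ) * z + ((g 1 1 : ℤ) : ℂ)) ^ 2) z := by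
  have hne := linear_ne_zero_of_det g hz
  have hnum : HasDerivAt (fun z : ℂ => ((g 0 0 : ℤ) : ℂ) * z + ((g 0 1 : ℤ) : ℂ))
      ((g 0 0 : ℤ) : ℂ) z := by
    simpa using ((hasDerivAt_id z).const_mul ((g 0 0 : ℤ) : ℂ)).add_const ((g 0 1 : ℤ) : ℂ)
  have hden : HasDerivAt (fun z : ℂ => ((g 1 0 : ℤ) : ℂ) * z + ((g 1 1 : ℤ) : ℂ))
      ((g 1 0 : ℤ) : ℂ) z := by
    simpa using ((hasDerivAt_id z).const_mul ((g 1 0 : ℤ) : ℂ)).add_const ((g 1 1 : ℤ) : ℂ)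
  have hdet : ((g 0 0 : ℤ) : ℂ) * ((g 1 1 : ℤ) : ℂ) - ((g 0 1 : ℤ) : ℂ) * ((g 1 0 : ℤ) : ℂ) = 1 := by
    exact_mod_cast det_eq_one g
  refine (hnum.div hden hne).congr_deriv ?_
  congr 1
  linear_combination hdet

/-- `IsMoebius g u v` says that `v` is the image of the real number `u` under `g`,
with the denominator cleared. -/
def IsMoebius (g : SL2Z) (u v : ℝ) : Prop :=
  v * ((g 1 0 : ℤ) * u + (g 1 1 : ℤ)) = (g 0 0 : ℤ) * u + (g 0 1 : ℤ)

namespace IsMoebius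

lemma mul {g h : SL2Z} {u v w : ℝ} (hg : IsMoebius g v w) (hh : IsMoebius h u v) :
    IsMoebius (g * h) u w := by
  simp only [IsMoebius, Matrix.SpecialLinearGroup.coe_mul, Matrix.mul_apply, Fin.sum_univ_two,
    Int.cast_add, Int.cast_mul] at *
  linear_combination ((h 1 0 : ℝ) * u + h 1 1) * hg + ((g 0 0 : ℝ) - w * g 1 0) * hh

lemma inv {g : SL2Z} {u v : ℝ} (hg : IsMoebius g u v) : IsMoebius g⁻¹ v u := by
  simp only [IsMoebius, Matrix.SpecialLinearGroup.coe_inv, Matrix.adjugate_fin_two] at *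
  simp
  linear_combination -hg

lemma one (u : ℝ) : IsMoebius 1 u u := by simp [IsMoebius]

lemma denom_ne_zero {g : SL2Z} {u v : ℝ} (hg : IsMoebius g u v) :
    ((g 1 0 : ℤ) : ℝ) * u + (g 1 1 : ℤ) ≠ 0 := by
  intro h
  have hdet : ((g 0 0 : ℤ) : ℝ) * ((g 1 1 : ℤ) : ℝ) - ((g 0 1 : ℤ) : ℝ) * ((g 1 0 : ℤ) : ℝ) = 1 := by
    exact_mod_cast det_eq_one g
  have h2 : ((g 0 0 : ℤ) : ℝ) * u + (g 0 1 : ℤ) = 0 := by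
    rw [← hg, h, mul_zero]
  have h3 : (1 : ℝ) = 0 := by
    by_cases hc : ((g 1 0 : ℤ) : ℝ) = 0
    · have hd : ((g 1 1 : ℤ) : ℝ) = 0 := by simpa [hc] using h
      rw [← hdet, hc, hd]; ring
    · apply mul_left_cancel₀ hc
      linear_combination (-(g 1 0 : ℝ)) * hdet + (g 0 0 : ℝ) * (g 1 0 : ℝ) * h -
        (g 1 0 : ℝ) ^ 2 * h2
  exact one_ne_zero h3

lemma eta_actC {g : SL2Z} {u v u' v' : ℝ} (h : IsMoebius g u v) (h' : IsMoebius g u' v')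
    {z : ℂ} (hz : 0 < z.im) :
    eta v v' (actC (g : Matrix (Fin 2) (Fin 2) ℤ) z) *
      (1 / (((g 1 0 : ℤ) : ℂ) * z + ((g 1 1 : ℤ) : ℂ)) ^ 2) = eta u u' z := by
  have hdet : ((g 0 0 : ℤ) : ℂ) * ((g 1 1 : ℤ) : ℂ) - ((g 0 1 : ℤ) : ℂ) * ((g 1 0 : ℤ) : ℂ) = 1 := by
    exact_mod_cast det_eq_one g
  have hD := linear_ne_zero_of_det g hz
  have key : ∀ x y : ℝ, IsMoebius g x y →
      1 / (actC (g : Matrix (Fin 2) (Fin 2) ℤ) z - y) =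
        (((g 1 0 : ℤ) : ℂ) * z + ((g 1 1 : ℤ) : ℂ)) *
          ((((g 1 0 : ℤ) : ℂ) * z + ((g 1 1 : ℤ) : ℂ)) / (z - x) - (g 1 0 : ℤ)) := by
    intro x y hxy
    have hw := sub_ofReal_ne_zero (im_actC_pos g hz) y
    have hx := sub_ofReal_ne_zero hz x
    have hxy' : (y : ℂ) * ((g 1 0 : ℤ) * x + (g 1 1 : ℤ)) = (g 0 0 : ℤ) * x + (g 0 1 : ℤ) := by
      exact_mod_cast hxy
    have hact : actC (g : Matrix (Fin 2) (Fin 2) ℤ) z *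
        (((g 1 0 : ℤ) : ℂ) * z + ((g 1 1 : ℤ) : ℂ)) = (g 0 0 : ℤ) * z + (g 0 1 : ℤ) := by
      rw [actC, div_mul_cancel₀ _ hD]
    rw [div_eq_iff hw]
    field_simp
    linear_combination (-((g 1 0 : ℤ) * x + (g 1 1 : ℤ) : ℂ)) * hact +
      (((g 1 0 : ℤ) : ℂ) * z + ((g 1 1 : ℤ) : ℂ)) * hxy' - (z - x) * hdet
  rw [eta, key u v h, key u' v' h', eta]
  have hx := sub_ofReal_ne_zero hz u
  have hx' := sub_ofReal_ne_zero hz u'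
  field_simp
  ring

end IsMoebius

lemma convex_im_pos : Convex ℝ {z : ℂ | 0 < z.im} := convex_halfSpace_im_gt 0

lemma isOpen_im_pos : IsOpen {z : ℂ | 0 < z.im} := isOpen_lt continuous_const Complex.continuous_im

lemma le_im_segment {a b : ℂ} {t : ℝ} (ht : t ∈ Set.Icc (0 : ℝ) 1) :
    min a.im b.im ≤ (a + t * (b - a)).im := by
  obtain ⟨h0, h1⟩ := ht
  have : (a + t * (b - a)).im = (1 - t) * a.im + t * b.im := by simp; ring
  rw [this]
  nlinarith [min_le_left a.im b.im, min_le_right a.im b.im]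

lemma im_segment_pos {a b : ℂ} (ha : 0 < a.im) (hb : 0 < b.im) {t : ℝ}
    (ht : t ∈ Set.Icc (0 : ℝ) 1) : 0 < (a + t * (b - a)).im :=
  (lt_min ha hb).trans_le (le_im_segment ht)

lemma continuousOn_comp_segment {h : ℂ → ℂ} (hh : ContinuousOn h {z : ℂ | 0 < z.im})
    {a b : ℂ} (ha : 0 < a.im) (hb : 0 < b.im) :
    ContinuousOn (fun t : ℝ => h (a + t * (b - a))) (Set.Icc 0 1) :=
  hh.comp (by fun_prop) fun _ ht => im_segment_pos ha hb ht

lemma segInt_eq_sub {P h : ℂ → ℂ} (hP : ∀ z : ℂ, 0 < z.im → HasDerivAt P (h z) z)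
    (hh : ContinuousOn h {z : ℂ | 0 < z.im}) {a b : ℂ} (ha : 0 < a.im) (hb : 0 < b.im) :
    segInt h a b = P b - P a := by
  have hI : Set.uIcc (0 : ℝ) 1 = Set.Icc 0 1 := Set.uIcc_of_le zero_le_one
  rw [segInt, ← intervalIntegral.integral_const_mul,
    intervalIntegral.integral_eq_sub_of_hasDerivAt (f := fun t : ℝ => P (a + t * (b - a)))]
  · simp
  · intro t ht
    rw [hI] at ht
    have h1 : HasDerivAt (fun t : ℝ => a + (t : ℂ) * (b - a)) (b - a) t := by
      simpa using ((Complex.ofRealCLM.hasDerivAt (x := t)).mul_const (b - a)).const_add a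
    rw [mul_comm]
    exact (hP _ (im_segment_pos ha hb ht)).comp t h1
  · apply ContinuousOn.intervalIntegrable
    rw [hI]
    exact continuousOn_const.mul (continuousOn_comp_segment hh ha hb)

lemma differentiableOn_eta (u u' : ℝ) : DifferentiableOn ℂ (eta u u') {z : ℂ | 0 < z.im} := by
  have h (x : ℝ) : DifferentiableOn ℂ (fun z : ℂ => 1 / (z - x)) {z : ℂ | 0 < z.im} :=
    (differentiableOn_const 1).div (by fun_prop) fun z hz => sub_ofReal_ne_zero hz x
  exact (h u').sub (h u)

lemma exists_primitive {f : ℂ → ℂ} (hf : DifferentiableOn ℂ f {z : ℂ | 0 < z.im}) (u u' : ℝ) :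
    ∃ P : ℂ → ℂ, ∀ z : ℂ, 0 < z.im → HasDerivAt P (f z * eta u u' z) z := by
  obtain ⟨P, hP⟩ := convex_im_pos.exists_forall_hasDerivWithinAt
    (hf.mul (differentiableOn_eta u u'))
  exact ⟨P, fun z hz => (hP z hz).hasDerivAt (isOpen_im_pos.mem_nhds hz)⟩

lemma cycInt_add {f : ℂ → ℂ} (hf : DifferentiableOn ℂ f {z : ℂ | 0 < z.im}) (u u' : ℝ)
    {a b c : ℂ} (ha : 0 < a.im) (hb : 0 < b.im) (hc : 0 < c.im) :
    cycInt f u u' a b + cycInt f u u' b c = cycInt f u u' a c := by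
  obtain ⟨P, hP⟩ := exists_primitive hf u u'
  have hcont := (hf.mul (differentiableOn_eta u u')).continuousOn
  simp only [cycInt]
  rw [segInt_eq_sub hP hcont ha hb, segInt_eq_sub hP hcont hb hc, segInt_eq_sub hP hcont ha hc]
  ring

lemma cycInt_actC {f : ℂ → ℂ} (hf : IsModular f) {g : SL2Z} {u v u' v' : ℝ}
    (h : IsMoebius g u v) (h' : IsMoebius g u' v') {a b : ℂ} (ha : 0 < a.im) (hb : 0 < b.im) :
    cycInt f v v' (actC (g : Matrix (Fin 2) (Fin 2) ℤ) a)
      (actC (g : Matrix (Fin 2) (Fin 2) ℤ) b) = cycInt f u u' a b := by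
  obtain ⟨P, hP⟩ := exists_primitive hf.1 v v'
  have hcont (x x' : ℝ) := (hf.1.mul (differentiableOn_eta x x')).continuousOn
  have hPg : ∀ z : ℂ, 0 < z.im →
      HasDerivAt (fun z => P (actC (g : Matrix (Fin 2) (Fin 2) ℤ) z)) (f z * eta u u' z) z := by
    intro z hz
    have := (hP _ (im_actC_pos g hz)).comp z (hasDerivAt_actC g hz)
    rwa [mul_assoc, h.eta_actC h' hz, hf.2 g z hz] at this
  simp only [cycInt]
  rw [segInt_eq_sub hP (hcont v v') (im_actC_pos g ha) (im_actC_pos g hb),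
    segInt_eq_sub hPg (hcont u u') ha hb]

lemma isModular_const (c : ℂ) : IsModular fun _ => c :=
  ⟨differentiableOn_const c, fun _ _ _ => rfl⟩

lemma norm_one_div_sub_ofReal_le {z : ℂ} {δ : ℝ} (hδ : 0 < δ) (hz : δ ≤ z.im) (u : ℝ) :
    ‖1 / (z - u)‖ ≤ 1 / δ := by
  rw [norm_div, norm_one]
  apply one_div_le_one_div_of_le hδ
  have := Complex.abs_im_le_norm (z - u)
  simp only [Complex.sub_im, Complex.ofReal_im, sub_zero] at this
  exact hz.trans ((le_abs_self _).trans this)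

lemma norm_one_div_sub_sub_le {z : ℂ} {δ : ℝ} (hδ : 0 < δ) (hz : δ ≤ z.im) (u v : ℝ) :
    ‖1 / (z - u) - 1 / (z - v)‖ ≤ (2 / δ + 1 / δ ^ 2) * min 1 |u - v| := by
  have hu := norm_one_div_sub_ofReal_le hδ hz u
  have hv := norm_one_div_sub_ofReal_le hδ hz v
  have hδ2 : 0 < 1 / δ ^ 2 := by positivity
  have hδ1 : 0 < 2 / δ := by positivity
  rcases le_total 1 |u - v| with h | h
  · rw [min_eq_left h, mul_one]
    calc _ ≤ 1 / δ + 1 / δ := (norm_sub_le _ _).trans (add_le_add hu hv)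
      _ ≤ _ := by rw [← add_div]; norm_num; positivity
  · rw [min_eq_right h]
    have hu' := sub_ofReal_ne_zero (hδ.trans_le hz) u
    have hv' := sub_ofReal_ne_zero (hδ.trans_le hz) v
    have : 1 / (z - u) - 1 / (z - v) = 1 / (z - u) * (1 / (z - v)) * ((u - v : ℝ) : ℂ) := by
      push_cast
      field_simp
      ring
    rw [this, norm_mul, norm_mul, Complex.norm_real, Real.norm_eq_abs]
    apply mul_le_mul_of_nonneg_right _ (abs_nonneg _)
    calc _ ≤ 1 / δ * (1 / δ) := by gcongr
      _ = 1 / δ ^ 2 := by rw [div_mul_div_comm, one_mul, sq]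
      _ ≤ _ := by linarith

lemma exists_norm_cycInt_sub_le {f : ℂ → ℂ} (hf : ContinuousOn f {z : ℂ | 0 < z.im})
    {a b : ℂ} (ha : 0 < a.im) (hb : 0 < b.im) :
    ∃ K : ℝ, 0 ≤ K ∧ ∀ u u' v v' : ℝ, ‖cycInt f u u' a b - cycInt f v v' a b‖ ≤
      K * (min 1 |u - v| + min 1 |u' - v'|) := by
  have hI : Set.uIcc (0 : ℝ) 1 = Set.Icc 0 1 := Set.uIcc_of_le zero_le_one
  obtain ⟨C, hC⟩ := isCompact_Icc.exists_bound_of_continuousOn (continuousOn_comp_segment hf ha hb)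
  set δ := min a.im b.im
  have hδ : 0 < δ := lt_min ha hb
  have hC0 : 0 ≤ C := (norm_nonneg _).trans (hC 0 (by simp))
  refine ⟨‖b - a‖ * (C * (2 / δ + 1 / δ ^ 2)), by positivity, fun u u' v v' => ?_⟩
  have hint (x x' : ℝ) : IntervalIntegrable (fun t : ℝ =>
      f (a + t * (b - a)) * eta x x' (a + t * (b - a))) MeasureTheory.volume 0 1 := by
    apply ContinuousOn.intervalIntegrable
    rw [hI]
    exact continuousOn_comp_segment (hf.mul (differentiableOn_eta x x').continuousOn) ha hb
  simp only [cycInt, segInt]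
  rw [← mul_sub, ← intervalIntegral.integral_sub (hint u u') (hint v v'), norm_mul, mul_assoc]
  apply mul_le_mul_of_nonneg_left _ (norm_nonneg _)
  have hbound := intervalIntegral.norm_integral_le_of_norm_le_const (a := (0 : ℝ)) (b := 1)
    (f := fun t : ℝ => f (a + t * (b - a)) * eta u u' (a + t * (b - a)) -
      f (a + t * (b - a)) * eta v v' (a + t * (b - a)))
    (C := C * (2 / δ + 1 / δ ^ 2) * (min 1 |u - v| + min 1 |u' - v'|)) ?_
  · simpa using hbound
  · intro t ht
    rw [Set.uIoc_of_le zero_le_one] at ht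
    have ht' := Set.Ioc_subset_Icc_self ht
    rw [← mul_sub, norm_mul, mul_assoc]
    apply mul_le_mul (hC t ht') _ (norm_nonneg _) hC0
    have hz : δ ≤ (a + t * (b - a)).im := le_im_segment ht'
    have e : eta u u' (a + t * (b - a)) - eta v v' (a + t * (b - a)) =
        (1 / (a + t * (b - a) - u') - 1 / (a + t * (b - a) - v')) -
        (1 / (a + t * (b - a) - u) - 1 / (a + t * (b - a) - v)) := by
      simp only [eta]; ring
    rw [e, mul_add, add_comm (_ * min 1 |u - v|)]
    exact (norm_sub_le _ _).trans (add_le_add (norm_one_div_sub_sub_le hδ hz u' v')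
      (norm_one_div_sub_sub_le hδ hz u v))

lemma exists_norm_cycInt_le {f : ℂ → ℂ} (hf : ContinuousOn f {z : ℂ | 0 < z.im})
    {a b : ℂ} (ha : 0 < a.im) (hb : 0 < b.im) :
    ∃ K : ℝ, ∀ u u' : ℝ, ‖cycInt f u u' a b‖ ≤ K := by
  obtain ⟨K, hK, h⟩ := exists_norm_cycInt_sub_le hf ha hb
  refine ⟨K * 2 + ‖cycInt f 0 0 a b‖, fun u u' => ?_⟩
  have h1 := h u u' 0 0
  have h2 := norm_sub_norm_le (cycInt f u u' a b) (cycInt f 0 0 a b)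
  have h3 := mul_le_mul_of_nonneg_left
    (add_le_add (min_le_left 1 |u - 0|) (min_le_left 1 |u' - 0|)) hK
  linarith

lemma cycInt_self (f : ℂ → ℂ) (u u' : ℝ) (a : ℂ) : cycInt f u u' a a = 0 := by
  simp [cycInt, segInt]

section Stabilizer

variable {f : ℂ → ℂ} {z0 : ℂ} {u u' : ℝ}

lemma cycInt_actC_mul (hf : IsModular f) (hz0 : 0 < z0.im) {g h : SL2Z}
    (hg : IsMoebius g u u) (hg' : IsMoebius g u' u') :
    cycInt f u u' z0 (actC ((g * h : SL2Z) : Matrix (Fin 2) (Fin 2) ℤ) z0) =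
      cycInt f u u' z0 (actC (g : Matrix (Fin 2) (Fin 2) ℤ) z0) +
        cycInt f u u' z0 (actC (h : Matrix (Fin 2) (Fin 2) ℤ) z0) := by
  rw [actC_mul g h hz0, ← cycInt_actC hf hg hg' hz0 (im_actC_pos h hz0),
    cycInt_add hf.1 u u' hz0 (im_actC_pos g hz0) (im_actC_pos g (im_actC_pos h hz0))]

lemma cycInt_actC_inv (hf : IsModular f) (hz0 : 0 < z0.im) {g : SL2Z}
    (hg : IsMoebius g u u) (hg' : IsMoebius g u' u') :
    cycInt f u u' z0 (actC ((g⁻¹ : SL2Z) : Matrix (Fin 2) (Fin 2) ℤ) z0) =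
      -cycInt f u u' z0 (actC (g : Matrix (Fin 2) (Fin 2) ℤ) z0) := by
  have h := cycInt_actC_mul hf hz0 (h := g⁻¹) hg hg'
  rw [mul_inv_cancel, actC_one, cycInt_self] at h
  linear_combination -h

lemma IsMoebius.zpow {g : SL2Z} (hg : IsMoebius g u u) (m : ℤ) : IsMoebius (g ^ m) u u := by
  induction m using Int.induction_on with
  | zero => simpa using IsMoebius.one u
  | succ n ih => rw [_root_.zpow_add_one]; exact ih.mul hg
  | pred n ih => rw [_root_.zpow_sub_one]; exact ih.mul hg.inv

lemma cycInt_actC_zpow (hf : IsModular f) (hz0 : 0 < z0.im) {g : SL2Z}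
    (hg : IsMoebius g u u) (hg' : IsMoebius g u' u') (m : ℤ) :
    cycInt f u u' z0 (actC ((g ^ m : SL2Z) : Matrix (Fin 2) (Fin 2) ℤ) z0) =
      m * cycInt f u u' z0 (actC (g : Matrix (Fin 2) (Fin 2) ℤ) z0) := by
  induction m using Int.induction_on with
  | zero => rw [zpow_zero, actC_one, cycInt_self]; simp
  | succ n ih =>
    rw [_root_.zpow_add_one, cycInt_actC_mul hf hz0 (hg.zpow _) (hg'.zpow _), ih]
    push_cast
    ring
  | pred n ih =>
    rw [_root_.zpow_sub_one, cycInt_actC_mul hf hz0 (hg.zpow _) (hg'.zpow _), ih,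
      cycInt_actC_inv hf hz0 hg hg']
    push_cast
    ring

end Stabilizer

lemma IsMoebius.of_commute {g M : SL2Z} {u : ℝ} (hM : IsMoebius M u u) (hc : M 1 0 ≠ 0)
    (h : (M : Matrix (Fin 2) (Fin 2) ℤ) * (g : Matrix (Fin 2) (Fin 2) ℤ) = g * M) :
    IsMoebius g u u := by
  have hc' : ((M 1 0 : ℤ) : ℝ) ≠ 0 := by exact_mod_cast hc
  have h00 : ((M 0 1 * g 1 0 : ℤ) : ℝ) = ((g 0 1 * M 1 0 : ℤ) : ℝ) := by
    have := congrFun (congrFun h 0) 0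
    simp only [Matrix.mul_apply, Fin.sum_univ_two] at this
    congr 1
    linear_combination this
  have h10 : ((M 1 0 * g 0 0 + M 1 1 * g 1 0 : ℤ) : ℝ) =
      ((g 1 0 * M 0 0 + g 1 1 * M 1 0 : ℤ) : ℝ) := by
    have := congrFun (congrFun h 1) 0
    simp only [Matrix.mul_apply, Fin.sum_univ_two] at this
    congr 1
  push_cast at h00 h10
  apply mul_left_cancel₀ hc'
  rw [IsMoebius] at hM
  linear_combination (g 1 0 : ℝ) * hM - u * h10 + h00

lemma isMoebius_of_actR_eq {g : SL2Z} {u v : ℝ}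
    (hne : ((g 1 0 : ℤ) : ℝ) * u + (g 1 1 : ℤ) ≠ 0)
    (h : actR (g : Matrix (Fin 2) (Fin 2) ℤ) u = v) : IsMoebius g u v := by
  rw [actR, div_eq_iff hne] at h
  exact h.symm

lemma IsMoebius.actR_eq {g : SL2Z} {u v : ℝ} (h : IsMoebius g u v) :
    actR (g : Matrix (Fin 2) (Fin 2) ℤ) u = v := by
  rw [actR, div_eq_iff h.denom_ne_zero]
  exact Eq.symm h

/-- The quotient of cycle integrals may be computed with any automorph whose lower left
entry is nonzero. -/
lemma IsFundAutomorph.cycInt_div_eq {f : ℂ → ℂ} (hf : IsModular f) {z0 : ℂ} (hz0 : 0 < z0.im)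
    {u u' : ℝ} {g M : SL2Z} (hg : IsFundAutomorph u g)
    (hM : IsMoebius M u u) (hM' : IsMoebius M u' u') (hc : M 1 0 ≠ 0) :
    cycInt f u u' z0 (actC (g : Matrix (Fin 2) (Fin 2) ℤ) z0) /
        cycInt (fun _ => 1) u u' z0 (actC (g : Matrix (Fin 2) (Fin 2) ℤ) z0) =
      cycInt f u u' z0 (actC (M : Matrix (Fin 2) (Fin 2) ℤ) z0) /
        cycInt (fun _ => 1) u u' z0 (actC (M : Matrix (Fin 2) (Fin 2) ℤ) z0) := by
  obtain ⟨hgu, hε, hstab⟩ := hg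
  obtain ⟨m, hm⟩ := (hstab M).1 hM.actR_eq
  have hcomm : (M : Matrix (Fin 2) (Fin 2) ℤ) * (g : Matrix (Fin 2) (Fin 2) ℤ) = g * M := by
    have : ((g ^ m * g : SL2Z) : Matrix (Fin 2) (Fin 2) ℤ) = (g * g ^ m : SL2Z) := by
      rw [(Commute.zpow_self g m).eq]
    rw [Matrix.SpecialLinearGroup.coe_mul, Matrix.SpecialLinearGroup.coe_mul] at this
    rcases hm with hm | hm
    · rw [hm, this]
    · rw [hm, neg_mul, mul_neg, this]
  have hgM' := hM'.of_commute hc hcomm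
  have hgM := hM.of_commute hc hcomm
  have hact : actC (M : Matrix (Fin 2) (Fin 2) ℤ) z0 =
      actC ((g ^ m : SL2Z) : Matrix (Fin 2) (Fin 2) ℤ) z0 := by
    rcases hm with hm | hm
    · rw [hm]
    · rw [hm, actC_neg]
  have hm0 : (m : ℂ) ≠ 0 := by
    rw [Int.cast_ne_zero]
    rintro rfl
    rcases hm with hm | hm <;> exact hc (by simp [hm])
  rw [hact, cycInt_actC_zpow hf hz0 hgM hgM',
    cycInt_actC_zpow (isModular_const 1) hz0 hgM hgM', mul_div_mul_left _ _ hm0]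

lemma actC_ne_self {M : SL2Z} {u : ℝ} (hM : IsMoebius M u u) (hc : M 1 0 ≠ 0) {z : ℂ}
    (hz : 0 < z.im) : actC (M : Matrix (Fin 2) (Fin 2) ℤ) z ≠ z := by
  intro h
  rw [actC, div_eq_iff (linear_ne_zero_of_det M hz)] at h
  have hMc : (u : ℂ) * ((M 1 0 : ℤ) * u + (M 1 1 : ℤ)) = (M 0 0 : ℤ) * u + (M 0 1 : ℤ) := by
    exact_mod_cast hM
  have key : ((M 1 0 : ℤ) : ℂ) * (z + u) + (M 1 1 : ℤ) - (M 0 0 : ℤ) = 0 := by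
    apply mul_left_cancel₀ (sub_ofReal_ne_zero hz u)
    linear_combination -hMc - h
  have him := congrArg Complex.im key
  simp at him
  exact him.elim hc hz.ne'

lemma cycInt_one_ne_zero {u u' : ℝ} (hne : u' ≠ u) {a b : ℂ} (ha : 0 < a.im) (hb : 0 < b.im)
    (hab : b ≠ a) : cycInt (fun _ => 1) u u' a b ≠ 0 := by
  have hslit (x : ℝ) {z : ℂ} (hz : 0 < z.im) : z - x ∈ Complex.slitPlane := by
    rw [Complex.mem_slitPlane_iff]
    right
    simpa using hz.ne'
  have hlog (x : ℝ) {z : ℂ} (hz : 0 < z.im) :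
      HasDerivAt (fun z : ℂ => Complex.log (z - x)) (1 / (z - x)) z :=
    ((hasDerivAt_id z).sub_const (x : ℂ)).clog (hslit x hz)
  have hcont : ContinuousOn (fun z => (1 : ℂ) * eta u u' z) {z : ℂ | 0 < z.im} :=
    continuousOn_const.mul (differentiableOn_eta u u').continuousOn
  intro h
  rw [cycInt, segInt_eq_sub (P := fun z : ℂ => Complex.log (z - u') - Complex.log (z - u))
    (fun z hz => by rw [one_mul]; exact (hlog u' hz).sub (hlog u hz)) hcont ha hb, sub_eq_zero] at h
  have hexp := congrArg Complex.exp h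
  have hau := sub_ofReal_ne_zero ha u
  have hau' := sub_ofReal_ne_zero ha u'
  have hbu := sub_ofReal_ne_zero hb u
  have hbu' := sub_ofReal_ne_zero hb u'
  rw [Complex.exp_sub, Complex.exp_sub, Complex.exp_log hau, Complex.exp_log hau',
    Complex.exp_log hbu, Complex.exp_log hbu', div_eq_div_iff hbu hau] at hexp
  have huu : ((u' : ℂ) - u) ≠ 0 := by
    rw [sub_ne_zero]
    exact_mod_cast hne
  apply hab
  apply mul_right_cancel₀ huu
  linear_combination hexp

/-- Nonnegative entries, with positive diagonal. -/
structure NonnegEntries (M : SL2Z) : Prop where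
  a : 1 ≤ M 0 0
  b : 0 ≤ M 0 1
  c : 0 ≤ M 1 0
  d : 1 ≤ M 1 1

namespace NonnegEntries

variable {M : SL2Z}

lemma exists_isMoebius (hM : NonnegEntries M) {x : ℝ} (hx : 0 < x) :
    ∃ v, 0 < v ∧ IsMoebius M x v := by
  have ha : (1 : ℝ) ≤ (M 0 0 : ℤ) := by exact_mod_cast hM.a
  have hb : (0 : ℝ) ≤ (M 0 1 : ℤ) := by exact_mod_cast hM.b
  have hc : (0 : ℝ) ≤ (M 1 0 : ℤ) := by exact_mod_cast hM.c
  have hd : (1 : ℝ) ≤ (M 1 1 : ℤ) := by exact_mod_cast hM.d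
  have hD : 0 < (M 1 0 : ℤ) * x + (M 1 1 : ℤ) := by positivity
  refine ⟨((M 0 0 : ℤ) * x + (M 0 1 : ℤ)) / ((M 1 0 : ℤ) * x + (M 1 1 : ℤ)), ?_, ?_⟩
  · positivity
  · rw [IsMoebius, div_mul_cancel₀ _ hD.ne']

lemma exists_isMoebius_neg (hM : NonnegEntries M) {y : ℝ} (hy : 0 < y) :
    ∃ v, 0 < v ∧ IsMoebius M (-v) (-y) := by
  have ha : (1 : ℝ) ≤ (M 0 0 : ℤ) := by exact_mod_cast hM.a
  have hb : (0 : ℝ) ≤ (M 0 1 : ℤ) := by exact_mod_cast hM.b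
  have hc : (0 : ℝ) ≤ (M 1 0 : ℤ) := by exact_mod_cast hM.c
  have hd : (1 : ℝ) ≤ (M 1 1 : ℤ) := by exact_mod_cast hM.d
  have hD : 0 < (M 1 0 : ℤ) * y + (M 0 0 : ℤ) := by positivity
  refine ⟨((M 1 1 : ℤ) * y + (M 0 1 : ℤ)) / ((M 1 0 : ℤ) * y + (M 0 0 : ℤ)), ?_, ?_⟩
  · positivity
  · rw [IsMoebius]
    field_simp
    ring

end NonnegEntries

lemma exists_SL2Z_eq_gammaWord : ∀ W : List ℕ+, Even W.length →
    ∃ M : SL2Z, (M : Matrix (Fin 2) (Fin 2) ℤ) = gammaWord W ∧ NonnegEntries M ∧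
      (W ≠ [] → 1 ≤ M 0 1 ∧ 1 ≤ M 1 0)
  | [], _ => ⟨1, by simp [gammaWord], ⟨by simp, by simp, by simp, by simp⟩, by simp⟩
  | [x], h => by simp at h
  | x :: y :: l, h => by
    obtain ⟨M, hM, hM0, -⟩ := exists_SL2Z_eq_gammaWord l (by
      simpa [Nat.even_add_one] using h)
    have hx : (1 : ℤ) ≤ x := by exact_mod_cast x.pos
    have hy : (1 : ℤ) ≤ y := by exact_mod_cast y.pos
    obtain ⟨ha, hb, hc, hd⟩ := hM0
    let N : SL2Z := ⟨cfMat x * cfMat y, by simp [cfMat, Matrix.det_fin_two]⟩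
    have h00 : (N * M) 0 0 = (x * y + 1) * M 0 0 + x * M 1 0 := by
      rw [Matrix.SpecialLinearGroup.coe_mul]
      simp [N, cfMat, Matrix.mul_apply, Fin.sum_univ_two]
    have h01 : (N * M) 0 1 = (x * y + 1) * M 0 1 + x * M 1 1 := by
      rw [Matrix.SpecialLinearGroup.coe_mul]
      simp [N, cfMat, Matrix.mul_apply, Fin.sum_univ_two]
    have h10 : (N * M) 1 0 = y * M 0 0 + M 1 0 := by
      rw [Matrix.SpecialLinearGroup.coe_mul]
      simp [N, cfMat, Matrix.mul_apply, Fin.sum_univ_two]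
    have h11 : (N * M) 1 1 = y * M 0 1 + M 1 1 := by
      rw [Matrix.SpecialLinearGroup.coe_mul]
      simp [N, cfMat, Matrix.mul_apply, Fin.sum_univ_two]
    have hxy : (0 : ℤ) < x * y := by positivity
    have e01 : 1 ≤ (N * M) 0 1 := by
      rw [h01]
      nlinarith [mul_nonneg hxy.le hb, mul_pos (zero_lt_one.trans_le hx) (zero_lt_one.trans_le hd)]
    have e10 : 1 ≤ (N * M) 1 0 := by
      rw [h10]; nlinarith [mul_pos (zero_lt_one.trans_le hy) (zero_lt_one.trans_le ha)]
    refine ⟨N * M, ?_, ⟨?_, by linarith, by linarith, ?_⟩, fun _ => ⟨e01, e10⟩⟩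
    · rw [Matrix.SpecialLinearGroup.coe_mul, hM]
      simp [N, gammaWord, Matrix.mul_assoc]
    · rw [h00]; nlinarith [mul_pos hxy (zero_lt_one.trans_le ha), mul_nonneg (zero_le_one.trans hx) hc]
    · rw [h11]; nlinarith [mul_nonneg (zero_le_one.trans hy) hb]

lemma gammaWord_append (V W : List ℕ+) : gammaWord (V ++ W) = gammaWord V * gammaWord W := by
  simp [gammaWord]

lemma gammaWord_wordPow (W : List ℕ+) (n : ℕ) : gammaWord (wordPow W n) = gammaWord W ^ n := by
  induction n with
  | zero => simp [wordPow, gammaWord]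
  | succ n ih =>
    rw [pow_succ', ← ih, ← gammaWord_append]
    simp [wordPow, List.replicate_succ]

/-- Basic properties of the matrix of a non-empty even word and its fixed points. -/
lemma fixedPoints_of_isCFConj {W : List ℕ+} {M : SL2Z}
    (hMW : (M : Matrix (Fin 2) (Fin 2) ℤ) = gammaWord W) (hM : NonnegEntries M)
    (hb : 1 ≤ M 0 1) (hc : 1 ≤ M 1 0) {w w' : ℝ} (hw : IsCFValue W w) (hw' : IsCFConj W w w') :
    IsMoebius M w w ∧ IsMoebius M w' w' ∧ w' < 0 ∧
      ((M 1 0 : ℤ) : ℝ) * (w + w') = (M 0 0 : ℤ) - (M 1 1 : ℤ) := by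
  have hbR : (1 : ℝ) ≤ (M 0 1 : ℤ) := by exact_mod_cast hb
  have hcR : (1 : ℝ) ≤ (M 1 0 : ℤ) := by exact_mod_cast hc
  have hdR : (1 : ℝ) ≤ (M 1 1 : ℤ) := by exact_mod_cast hM.d
  obtain ⟨h1, hfix⟩ := hw
  obtain ⟨hne, hfix'⟩ := hw'
  rw [← hMW] at hfix hfix'
  have m : IsMoebius M w w := isMoebius_of_actR_eq (by positivity) hfix
  have m' : IsMoebius M w' w' := by
    refine isMoebius_of_actR_eq (fun h0 => ?_) hfix'
    have hw0 : w' = 0 := by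
      rw [← hfix', actR]
      exact div_eq_zero_iff.2 (Or.inr h0)
    rw [hw0] at h0
    linarith
  have hsum : ((M 1 0 : ℤ) : ℝ) * (w + w') = (M 0 0 : ℤ) - (M 1 1 : ℤ) := by
    apply mul_left_cancel₀ (sub_ne_zero.2 hne)
    rw [IsMoebius] at m m'
    linear_combination m' - m
  refine ⟨m, m', ?_, hsum⟩
  by_contra! hpos
  have hprod : ((M 1 0 : ℤ) : ℝ) * (w * w') = -(M 0 1 : ℤ) := by
    rw [IsMoebius] at m
    linear_combination w * hsum - m
  have : 0 ≤ ((M 1 0 : ℤ) : ℝ) * (w * w') := by positivity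
  linarith

lemma contraction_bound {p q r s y : ℝ} (hr1 : 1 ≤ r) (hs : 1 ≤ s)
    (hdet : p * s - q * r = 1) (hy : 0 < y) (hfix : y * (r * y + s) = p * y + q)
    (h2 : 2 ≤ r * y + s) {x : ℕ → ℝ} (hx : ∀ j, 0 < x j)
    (hrec : ∀ j, x (j + 1) * (r * x j + s) = p * x j + q) (j : ℕ) :
    min 1 |x j - y| ≤ (1 + y) * (1 / 2) ^ j := by
  have hD (j : ℕ) : 1 ≤ r * x j + s := by
    have hr : 0 ≤ r := by linarith
    nlinarith [mul_nonneg hr (hx j).le]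
  have hkey (j : ℕ) : |x (j + 1) - y| * ((r * x j + s) * (r * y + s)) = |x j - y| := by
    rw [← abs_of_pos (show 0 < (r * x j + s) * (r * y + s) by
      have := hD j; positivity), ← abs_mul]
    congr 1
    linear_combination (r * y + s) * hrec j - (r * x j + s) * hfix + (x j - y) * hdet
  have hstep (j : ℕ) : |x (j + 1) - y| ≤ (1 + y) * (1 / 2) ^ (j + 1) := by
    induction j with
    | zero =>
      have h0 := hkey 0
      have hle : |x 0 - y| ≤ (1 + y) * (r * x 0 + s) := by
        have := hx 0
        have hr : 0 ≤ r := by linarith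
        rw [abs_le]
        constructor <;> nlinarith [mul_nonneg (sub_nonneg.2 hr1) this.le,
          mul_nonneg hy.le (mul_nonneg hr this.le), mul_nonneg hy.le (sub_nonneg.2 hs)]
      have : |x 1 - y| * (r * y + s) ≤ 1 + y := by
        have hpos : 0 < r * x 0 + s := by linarith [hD 0]
        apply le_of_mul_le_mul_right _ hpos
        calc _ = |x (0 + 1) - y| * ((r * x 0 + s) * (r * y + s)) := by ring
          _ ≤ _ := by rw [h0]; exact hle
      have h3 := mul_le_mul_of_nonneg_left h2 (abs_nonneg (x 1 - y))
      norm_num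
      linarith
    | succ j ih =>
      have h0 := hkey (j + 1)
      have h4 : 2 ≤ (r * x (j + 1) + s) * (r * y + s) := by nlinarith [hD (j + 1)]
      have h3 := mul_le_mul_of_nonneg_left h4 (abs_nonneg (x (j + 1 + 1) - y))
      rw [pow_succ]
      linarith
  cases j with
  | zero => exact (min_le_left _ _).trans (by simpa using hy.le)
  | succ j => exact (min_le_right _ _).trans (hstep j)

/-- The integral along the automorph of `V₀ W₁ⁿ V₁` is `n` times that of `W₁`, up to a bounded
error. -/
lemma exists_norm_cycInt_sub_mul_le {f : ℂ → ℂ} (hf : IsModular f) {z0 : ℂ} (hz0 : 0 < z0.im)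
    {A B C : SL2Z} (hA : NonnegEntries A) (hB : NonnegEntries B) (hC : NonnegEntries C)
    (hBc : 1 ≤ B 1 0) {u u' : ℝ} (hu1 : 1 < u) (hu0 : u' < 0)
    (hu : IsMoebius B u u) (hu' : IsMoebius B u' u')
    (hsum : ((B 1 0 : ℤ) : ℝ) * (u + u') = (B 0 0 : ℤ) - (B 1 1 : ℤ)) :
    ∃ K : ℝ, ∀ (n : ℕ) (w w' : ℝ), 0 < w → w' < 0 → IsMoebius (A * B ^ n * C) w w →
      IsMoebius (A * B ^ n * C) w' w' →
      ‖cycInt f w w' z0 (actC ((A * B ^ n * C : SL2Z) : Matrix (Fin 2) (Fin 2) ℤ) z0) -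
        n * cycInt f u u' z0 (actC (B : Matrix (Fin 2) (Fin 2) ℤ) z0)‖ ≤ K := by
  have hcont := hf.1.continuousOn
  obtain ⟨KA, hKA⟩ := exists_norm_cycInt_le hcont hz0 (im_actC_pos A hz0)
  obtain ⟨KC, hKC⟩ := exists_norm_cycInt_le hcont hz0 (im_actC_pos C hz0)
  obtain ⟨KB, hKB0, hKB⟩ := exists_norm_cycInt_sub_le hcont hz0 (im_actC_pos B hz0)
  refine ⟨KA + KB * ((1 + u) * 2 + (1 - u') * 2) + KC, fun n w w' hw hw' hfix hfix' => ?_⟩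
  have hcR : (1 : ℝ) ≤ (B 1 0 : ℤ) := by exact_mod_cast hBc
  have haR : (1 : ℝ) ≤ (B 0 0 : ℤ) := by exact_mod_cast hB.a
  have hdR : (1 : ℝ) ≤ (B 1 1 : ℤ) := by exact_mod_cast hB.d
  have hdet : ((B 0 0 : ℤ) : ℝ) * ((B 1 1 : ℤ) : ℝ) - ((B 0 1 : ℤ) : ℝ) * ((B 1 0 : ℤ) : ℝ) = 1 := by
    exact_mod_cast det_eq_one B
  choose! T hT0 hT using fun x (hx : 0 < x) => hB.exists_isMoebius hx
  choose! S hS0 hS using fun y (hy : 0 < y) => hB.exists_isMoebius_neg hy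
  obtain ⟨x0, hx0, hCx⟩ := hC.exists_isMoebius hw
  obtain ⟨y0, hy0, hAy⟩ := hA.exists_isMoebius_neg (neg_pos.2 hw')
  rw [neg_neg] at hAy
  let x : ℕ → ℝ := fun j => T^[j] x0
  let y : ℕ → ℝ := fun j => S^[j] y0
  have xs (j : ℕ) : x (j + 1) = T (x j) := Function.iterate_succ_apply' T j x0
  have ys (j : ℕ) : y (j + 1) = S (y j) := Function.iterate_succ_apply' S j y0
  have xpos (j : ℕ) : 0 < x j := by
    induction j with
    | zero => exact hx0
    | succ j ih => rw [xs]; exact hT0 _ ih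
  have ypos (j : ℕ) : 0 < y j := by
    induction j with
    | zero => exact hy0
    | succ j ih => rw [ys]; exact hS0 _ ih
  have hxB (j : ℕ) : IsMoebius (B ^ j * C) w (x j) := by
    induction j with
    | zero => simpa [x] using hCx
    | succ j ih =>
      rw [pow_succ', mul_assoc, xs]
      exact (hT _ (xpos j)).mul ih
  have hyB (k : ℕ) : IsMoebius (A * B ^ k) (-y k) w' := by
    induction k with
    | zero => simpa [y] using hAy
    | succ k ih =>
      rw [pow_succ, ← mul_assoc, ys]
      exact ih.mul (hS _ (ypos k))
  have hxA {k : ℕ} (hk : k ≤ n) : IsMoebius (A * B ^ k) (x (n - k)) w := by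
    have h := hfix.mul (hxB (n - k)).inv
    have e : A * B ^ n * C * (B ^ (n - k) * C)⁻¹ = A * B ^ k := by
      nth_rewrite 1 [← Nat.add_sub_of_le hk]
      rw [pow_add]
      group
    rwa [e] at h
  have hxlim := contraction_bound hcR hdR hdet (by linarith) hu (by nlinarith) xpos
    fun j => by rw [xs]; exact hT _ (xpos j)
  have hylim := contraction_bound (p := (B 1 1 : ℤ)) (q := (B 0 1 : ℤ)) (y := -u')
    hcR haR (by linarith)
    (by linarith) (by rw [IsMoebius] at hu'; linear_combination hu') (by nlinarith) ypos
    fun j => by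
      have := hS _ (ypos j)
      rw [IsMoebius] at this
      rw [ys]
      linear_combination this
  set I : ℂ := cycInt f u u' z0 (actC (B : Matrix (Fin 2) (Fin 2) ℤ) z0)
  have hterm {k : ℕ} (hk : k ≤ n) :
      ‖cycInt f w w' (actC ((A * B ^ k : SL2Z) : Matrix (Fin 2) (Fin 2) ℤ) z0)
        (actC ((A * B ^ (k + 1) : SL2Z) : Matrix (Fin 2) (Fin 2) ℤ) z0) - I‖ ≤
      KB * ((1 + u) * (1 / 2) ^ (n - k) + (1 - u') * (1 / 2) ^ k) := by
    rw [pow_succ, ← mul_assoc, actC_mul _ B hz0,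
      cycInt_actC hf (hxA hk) (hyB k) hz0 (im_actC_pos B hz0)]
    refine (hKB _ _ _ _).trans (mul_le_mul_of_nonneg_left (add_le_add (hxlim _) ?_) hKB0)
    have := hylim k
    rwa [← abs_neg, show -(y k - -u') = -y k - u' by ring, ← sub_eq_add_neg] at this
  have htel (k : ℕ) (hk : k ≤ n) :
      ‖cycInt f w w' z0 (actC ((A * B ^ k : SL2Z) : Matrix (Fin 2) (Fin 2) ℤ) z0) - k * I‖ ≤
      KA + ∑ i ∈ Finset.range k, KB * ((1 + u) * (1 / 2) ^ (n - i) + (1 - u') * (1 / 2) ^ i) := by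
    induction k with
    | zero => simpa using hKA w w'
    | succ k ih =>
      rw [Finset.sum_range_succ, ← cycInt_add hf.1 w w' hz0 (im_actC_pos (A * B ^ k) hz0)
        (im_actC_pos (A * B ^ (k + 1)) hz0), ← add_assoc]
      refine le_trans (le_of_eq ?_) ((norm_add_le _ _).trans
        (add_le_add (ih (by omega)) (hterm (k := k) (by omega))))
      congr 1
      push_cast
      ring
  have hgeom : ∑ i ∈ Finset.range n, ((1 : ℝ) / 2) ^ i ≤ 2 := sum_geometric_two_le n
  have hgeom' : ∑ i ∈ Finset.range n, ((1 : ℝ) / 2) ^ (n - i) ≤ 2 := by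
    rw [← Finset.sum_range_reflect] at hgeom
    refine (Finset.sum_le_sum fun i hi => ?_).trans hgeom
    exact pow_le_pow_of_le_one (by norm_num) (by norm_num) (by omega)
  have hsumle : ∑ i ∈ Finset.range n, KB * ((1 + u) * (1 / 2) ^ (n - i) + (1 - u') * (1 / 2) ^ i) ≤
      KB * ((1 + u) * 2 + (1 - u') * 2) := by
    rw [← Finset.mul_sum, Finset.sum_add_distrib, ← Finset.mul_sum, ← Finset.mul_sum]
    have h1 : 0 ≤ 1 + u := by linarith
    have h2 : 0 ≤ 1 - u' := by linarith
    gcongr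
  have hlast : ‖cycInt f w w' (actC ((A * B ^ n : SL2Z) : Matrix (Fin 2) (Fin 2) ℤ) z0)
      (actC ((A * B ^ n * C : SL2Z) : Matrix (Fin 2) (Fin 2) ℤ) z0)‖ ≤ KC := by
    rw [actC_mul _ C hz0, cycInt_actC hf (hxA le_rfl) (hyB n) hz0 (im_actC_pos C hz0)]
    exact hKC _ _
  rw [← cycInt_add hf.1 w w' hz0 (im_actC_pos (A * B ^ n) hz0)
    (im_actC_pos (A * B ^ n * C) hz0), add_sub_right_comm]
  exact (norm_add_le _ _).trans (add_le_add ((htel n le_rfl).trans (by linarith)) hlast)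

lemma tendsto_div_natCast_of_norm_sub_le {F : ℕ → ℂ} {I : ℂ} {K : ℝ}
    (h : ∀ n : ℕ, 1 ≤ n → ‖F n - n * I‖ ≤ K) :
    Tendsto (fun n : ℕ => F n / n) atTop (𝓝 I) := by
  rw [tendsto_iff_norm_sub_tendsto_zero]
  refine squeeze_zero' (Eventually.of_forall fun _ => norm_nonneg _) ?_
    (tendsto_const_div_atTop_nhds_zero_nat K)
  filter_upwards [eventually_ge_atTop 1] with n hn
  have hn0 : (n : ℂ) ≠ 0 := by exact_mod_cast (by omega : n ≠ 0)
  have : F n / n - I = (F n - n * I) / n := by field_simp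
  rw [this, norm_div, Complex.norm_natCast]
  gcongr
  exact h n hn

/-- If `w₁ = [\overline{W₁}]`, then `f([\overline{V₀ W₁ⁿ V₁}]) → f(w₁)` as `n → ∞`. -/
theorem cycle_integral_continuity_single
    (f : ℂ → ℂ) (hf : IsModular f)
    (z0 : ℂ) (hz0 : 0 < z0.im)
    (V0 V1 : List ℕ+) (hV0 : Even V0.length) (hV1 : Even V1.length)
    (W1 : List ℕ+) (hW1ne : W1 ≠ []) (hW1e : Even W1.length)
    (w1 w1' : ℝ) (hw1 : IsCFValue W1 w1) (hw1' : IsCFConj W1 w1 w1')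
    (g1 : SL2Z) (hg1 : IsFundAutomorph w1 g1)
    (wn wn' : ℕ → ℝ)
    (hwn : ∀ n, IsCFValue (V0 ++ wordPow W1 n ++ V1) (wn n))
    (hwn' : ∀ n, IsCFConj (V0 ++ wordPow W1 n ++ V1) (wn n) (wn' n))
    (gn : ℕ → SL2Z) (hgn : ∀ n, IsFundAutomorph (wn n) (gn n)) :
    Tendsto (fun n =>
        cycInt f (wn n) (wn' n) z0 (actC (gn n : Matrix (Fin 2) (Fin 2) ℤ) z0) /
          cycInt (fun _ => 1) (wn n) (wn' n) z0 (actC (gn n : Matrix (Fin 2) (Fin 2) ℤ) z0))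
      atTop
      (𝓝 (cycInt f w1 w1' z0 (actC (g1 : Matrix (Fin 2) (Fin 2) ℤ) z0) /
          cycInt (fun _ => 1) w1 w1' z0 (actC (g1 : Matrix (Fin 2) (Fin 2) ℤ) z0))) := by
  obtain ⟨A, hA, hA0, -⟩ := exists_SL2Z_eq_gammaWord V0 hV0
  obtain ⟨C, hC, hC0, -⟩ := exists_SL2Z_eq_gammaWord V1 hV1
  obtain ⟨B, hB, hB0, hBpos⟩ := exists_SL2Z_eq_gammaWord W1 hW1e
  obtain ⟨hBb, hBc⟩ := hBpos hW1ne
  obtain ⟨hu, hu', hu0, hsum⟩ := fixedPoints_of_isCFConj hB hB0 hBb hBc hw1 hw1'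
  have hword : ∀ n : ℕ, 1 ≤ n → (A * B ^ n * C) 1 0 ≠ 0 ∧ wn' n < 0 ∧
      IsMoebius (A * B ^ n * C) (wn n) (wn n) ∧ IsMoebius (A * B ^ n * C) (wn' n) (wn' n) := by
    intro n hn
    have heven : Even (V0 ++ wordPow W1 n ++ V1).length := by
      simp only [wordPow, List.length_append, List.length_flatten, List.map_replicate,
        List.sum_replicate, smul_eq_mul]
      exact (hV0.add (hW1e.mul_left n)).add hV1
    have hne : V0 ++ wordPow W1 n ++ V1 ≠ [] := by
      obtain ⟨m, rfl⟩ := Nat.exists_eq_add_of_le' hn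
      simp [wordPow, List.replicate_succ, hW1ne]
    obtain ⟨M, hM, hM0, hMpos⟩ := exists_SL2Z_eq_gammaWord _ heven
    have hMeq : M = A * B ^ n * C := by
      apply Subtype.ext
      rw [hM, gammaWord_append, gammaWord_append, gammaWord_wordPow]
      simp [hA, hB, hC]
    obtain ⟨hb, hc⟩ := hMpos hne
    obtain ⟨h1, h2, h3, -⟩ := fixedPoints_of_isCFConj hM hM0 hb hc (hwn n) (hwn' n)
    rw [← hMeq]
    exact ⟨by omega, h3, h1, h2⟩
  have hlim {h : ℂ → ℂ} (hh : IsModular h) : Tendsto (fun n : ℕ =>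
      cycInt h (wn n) (wn' n) z0
        (actC ((A * B ^ n * C : SL2Z) : Matrix (Fin 2) (Fin 2) ℤ) z0) / n) atTop
      (𝓝 (cycInt h w1 w1' z0 (actC (B : Matrix (Fin 2) (Fin 2) ℤ) z0))) := by
    obtain ⟨K, hK⟩ := exists_norm_cycInt_sub_mul_le hh hz0 hA0 hB0 hC0 hBc hw1.1 hu0 hu hu' hsum
    refine tendsto_div_natCast_of_norm_sub_le (K := K) fun n hn => ?_
    obtain ⟨-, h3, h1, h2⟩ := hword n hn
    exact hK n _ _ (zero_lt_one.trans (hwn n).1) h3 h1 h2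
  have hBc0 : B 1 0 ≠ 0 := by omega
  have hden := cycInt_one_ne_zero hw1'.1 hz0 (im_actC_pos B hz0) (actC_ne_self hu hBc0 hz0)
  rw [hg1.cycInt_div_eq hf hz0 hu hu' hBc0]
  refine ((hlim hf).div (hlim (isModular_const 1)) hden).congr' ?_
  filter_upwards [eventually_ge_atTop 1] with n hn
  obtain ⟨hc, -, h1, h2⟩ := hword n hn
  have hn0 : (n : ℂ) ≠ 0 := by exact_mod_cast (by omega : n ≠ 0)
  rw [(hgn n).cycInt_div_eq hf hz0 h1 h2 hc]
  exact div_div_div_cancel_right₀ hn0 _ _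
end
end

section
/- Let w be a real quadratic irrational with Galois conjugate w', let γ_w = [[a,b],[c,d]] be its fundamental automorph and ε_w := c·w + d > 1. Then for every z_0 ∈ ℍ, the contour integral ∫_{z_0}^{γ_w z_0} η_w of (1/(z−w') − 1/(z−w)) along the straight line segment from z_0 to γ_w • z_0 equals 2·log(ε_w). In particular 1̃(w) = 2 log ε_w. -/
open Matrix Filter Topology

noncomputable section

/-- A linear form with integer coefficients vanishing at an irrational number is zero. -/
lemma int_coeffs_eq_zero_of_irrational {w : ℝ} (hw : Irrational w) {p q : ℤ}
    (h : (p : ℝ) * w + q = 0) : p = 0 ∧ q = 0 := by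
  have hp : p = 0 := by
    by_contra hp
    have hp' : (p : ℝ) ≠ 0 := by exact_mod_cast hp
    refine hw ⟨(-q : ℚ) / p, ?_⟩
    push_cast
    rw [div_eq_iff hp']
    linarith
  subst hp
  refine ⟨rfl, ?_⟩
  simpa using h

/-- If a quadratic irrational `w` is a root of `c X² + e X + f`, then Vieta's relations hold
for `w` and its conjugate. -/
lemma IsQuadPair.vieta {w w' : ℝ} (hq : IsQuadPair w w') {c e f : ℤ}
    (h : (c : ℝ) * w ^ 2 + e * w + f = 0) :
    (c : ℝ) * (w + w') = -e ∧ (c : ℝ) * (w * w') = f := by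
  obtain ⟨hw, hne, A, B, C, hA, h1, h2⟩ := hq
  have hA' : (A : ℝ) ≠ 0 := by exact_mod_cast hA
  obtain ⟨hp, hr⟩ := int_coeffs_eq_zero_of_irrational hw (p := A * e - c * B)
    (q := A * f - c * C) (by push_cast; linear_combination (A : ℝ) * h - c * h1)
  have hp' : (A : ℝ) * e - c * B = 0 := by exact_mod_cast hp
  have hr' : (A : ℝ) * f - c * C = 0 := by exact_mod_cast hr
  have hsum : (A : ℝ) * (w + w') = -B := by
    apply mul_left_cancel₀ (sub_ne_zero.2 hne)
    linear_combination h2 - h1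
  have hprod : (A : ℝ) * (w * w') = C := by linear_combination w * hsum - h1
  constructor
  · apply mul_left_cancel₀ hA'
    linear_combination (c : ℝ) * hsum + hp'
  · apply mul_left_cancel₀ hA'
    linear_combination (c : ℝ) * hprod - hr'

/-- `SL(2,ℤ)` preserves the upper half plane, with nonvanishing denominators. -/
lemma actC_denom_ne_zero_and_im_pos (g : SL2Z) {z : ℂ} (hz : 0 < z.im) :
    ((g 1 0 : ℤ) : ℂ) * z + (g 1 1 : ℤ) ≠ 0 ∧
      0 < (actC (g : Matrix (Fin 2) (Fin 2) ℤ) z).im := by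
  have hdet : (g 0 0 : ℝ) * g 1 1 - g 0 1 * g 1 0 = 1 := by
    exact_mod_cast (Matrix.det_fin_two g.1).symm.trans g.2
  have hne : ((g 1 0 : ℤ) : ℂ) * z + (g 1 1 : ℤ) ≠ 0 := by
    intro h
    have him : (g 1 0 : ℝ) * z.im = 0 := by simpa using congrArg Complex.im h
    have hre : (g 1 0 : ℝ) * z.re + g 1 1 = 0 := by simpa using congrArg Complex.re h
    have hc : (g 1 0 : ℝ) = 0 := (mul_eq_zero.1 him).resolve_right hz.ne'
    have hd : (g 1 1 : ℝ) = 0 := by simpa [hc] using hre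
    simp [hc, hd] at hdet
  refine ⟨hne, ?_⟩
  have him : (actC (g : Matrix (Fin 2) (Fin 2) ℤ) z).im =
      z.im / Complex.normSq (((g 1 0 : ℤ) : ℂ) * z + (g 1 1 : ℤ)) := by
    rw [actC, Complex.div_im, ← sub_div]
    congr 1
    simp only [Complex.add_im, Complex.add_re, Complex.mul_im, Complex.mul_re,
      Complex.intCast_re, Complex.intCast_im]
    linear_combination z.im * hdet
  rw [him]
  exact div_pos hz (Complex.normSq_pos.2 hne)

/-- On the upper half plane the difference of the principal logarithms is the principal
logarithm of the quotient. -/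
lemma log_sub_log_eq_log_div {u v : ℂ} (hu : 0 < u.im) (hv : 0 < v.im) :
    Complex.log u - Complex.log v = Complex.log (u / v) := by
  have hu0 : u ≠ 0 := by rintro rfl; simp at hu
  have hv0 : v ≠ 0 := by rintro rfl; simp at hv
  have hua := Complex.arg_nonneg_iff.2 hu.le
  have hva := Complex.arg_nonneg_iff.2 hv.le
  have hua' := Complex.arg_lt_pi_iff.2 (Or.inr hu.ne')
  have hva' := Complex.arg_lt_pi_iff.2 (Or.inr hv.ne')
  have hexp : Complex.exp (Complex.log u - Complex.log v) = u / v := by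
    rw [Complex.exp_sub, Complex.exp_log hu0, Complex.exp_log hv0]
  rw [← hexp, Complex.log_exp] <;> simp only [Complex.sub_im, Complex.log_im] <;> linarith

/-- The integral of `η` over a segment in the upper half plane. -/
lemma cycInt_one_eq (w w' : ℝ) {a b : ℂ} (ha : 0 < a.im) (hb : 0 < b.im) :
    cycInt (fun _ => 1) w w' a b =
      Complex.log ((b - w') / (b - w)) - Complex.log ((a - w') / (a - w)) := by
  have him (x : ℝ) {z : ℂ} (hz : 0 < z.im) : 0 < (z - x).im := by simpa using hz
  have hseg (t : ℝ) (ht : t ∈ Set.Icc (0 : ℝ) 1) : 0 < (a + t • (b - a)).im := by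
    have hmem := (convex_halfSpace_im_gt 0).add_smul_sub_mem (x := a) (y := b) ha hb ht
    exact hmem
  have hne (x : ℝ) {z : ℂ} (hz : 0 < z.im) : z - x ≠ 0 := by
    intro h
    have := him x hz
    simp [h] at this
  have hlog (x : ℝ) {z : ℂ} (hz : 0 < z.im) :
      HasDerivAt (fun z : ℂ => Complex.log (z - x)) (1 / (z - x)) z :=
    ((hasDerivAt_id z).sub_const (x : ℂ)).clog (Or.inr (him x hz).ne')
  have key := intervalIntegral.integral_unitInterval_deriv_eq_sub (𝕜 := ℂ)
    (f := fun z : ℂ => Complex.log (z - w') - Complex.log (z - w)) (f' := eta w w')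
    (z₀ := a) (z₁ := b - a) ?_ fun t ht => (hlog w' (hseg t ht)).sub (hlog w (hseg t ht))
  · rw [← log_sub_log_eq_log_div (him w' hb) (him w hb),
      ← log_sub_log_eq_log_div (him w' ha) (him w ha)]
    simpa [cycInt, segInt] using key
  · unfold eta
    refine ContinuousOn.sub ?_ ?_ <;>
      exact continuousOn_const.div (by fun_prop) fun t ht => hne _ (hseg t ht)

/-- `1̃(w) = ∫_{z₀}^{γ_w z₀} η_w = 2 log ε_w` for every basepoint `z₀ ∈ ℍ`. -/
theorem one_tilde_eq_two_log_eps
    (w w' : ℝ) (hq : IsQuadPair w w')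
    (g : SL2Z) (hg : IsFundAutomorph w g) :
    ∀ z0 : ℂ, 0 < z0.im →
      cycInt (fun _ => 1) w w' z0 (actC (g : Matrix (Fin 2) (Fin 2) ℤ) z0) =
        ((2 * Real.log ((g 1 0 : ℝ) * w + (g 1 1 : ℝ)) : ℝ) : ℂ) := by
  intro z hz
  obtain ⟨hfix, heps, -⟩ := hg
  obtain ⟨hden, hgz⟩ := actC_denom_ne_zero_and_im_pos g hz
  have hdet : (g 0 0 : ℝ) * g 1 1 - g 0 1 * g 1 0 = 1 := by
    exact_mod_cast (Matrix.det_fin_two g.1).symm.trans g.2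
  set ε : ℝ := (g 1 0 : ℝ) * w + (g 1 1 : ℝ) with hε
  have hε0 : 0 < ε := one_pos.trans heps
  have hfix' : (g 0 0 : ℝ) * w + g 0 1 = w * ε := (div_eq_iff hε0.ne').1 hfix
  obtain ⟨hsum, hprod⟩ := hq.vieta (c := g 1 0) (e := g 1 1 - g 0 0) (f := -g 0 1)
    (by push_cast; linear_combination -hfix' + w * hε)
  push_cast at hsum hprod
  have hconj : ε * ((g 1 0 : ℝ) * w' + g 1 1) = 1 := by
    linear_combination ((g 1 0 : ℝ) * w' + g 1 1) * hε + g 1 0 * hprod + g 1 1 * hsum + hdet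
  have hne (x : ℝ) {z : ℂ} (hz : 0 < z.im) : z - x ≠ 0 := by
    intro h
    have := congrArg Complex.im h
    simp at this
    exact hz.ne' this
  have hεC : (ε : ℂ) ≠ 0 := by exact_mod_cast hε0.ne'
  have hw : (actC (g : Matrix (Fin 2) (Fin 2) ℤ) z - w) =
      (z - w) / (((g 1 0 : ℤ) * z + (g 1 1 : ℤ)) * ε) := by
    have h1 : ((g 0 0 : ℤ) : ℂ) - w * (g 1 0 : ℤ) = 1 / ε := by
      rw [eq_div_iff hεC]
      have : ((g 0 0 : ℝ) - w * g 1 0) * ε = 1 := by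
        linear_combination hconj - ε * hsum
      exact_mod_cast this
    have h2 : ((g 0 0 : ℤ) : ℂ) * w + (g 0 1 : ℤ) = w * ((g 1 0 : ℤ) * w + (g 1 1 : ℤ)) := by
      exact_mod_cast hfix'
    rw [actC, div_sub' hden, mul_comm _ (ε : ℂ), ← div_div]
    congr 1
    rw [div_eq_mul_one_div, ← h1]
    linear_combination h2
  have hw' : (actC (g : Matrix (Fin 2) (Fin 2) ℤ) z - w') =
      (z - w') * ε / ((g 1 0 : ℤ) * z + (g 1 1 : ℤ)) := by
    have h1 : ((g 0 0 : ℤ) : ℂ) - w' * (g 1 0 : ℤ) = ε := by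
      have : (g 0 0 : ℝ) - w' * g 1 0 = ε := by linear_combination -hsum - hε
      exact_mod_cast this
    have h2 : ((g 0 0 : ℤ) : ℂ) * w' + (g 0 1 : ℤ) =
        w' * ((g 1 0 : ℤ) * w' + (g 1 1 : ℤ)) := by
      have : (g 0 0 : ℝ) * w' + g 0 1 = w' * (g 1 0 * w' + g 1 1) := by
        linear_combination -w' * hsum + hprod
      exact_mod_cast this
    rw [actC, div_sub' hden, ← h1]
    congr 1
    linear_combination h2
  have hratio : (actC (g : Matrix (Fin 2) (Fin 2) ℤ) z - w') /
      (actC (g : Matrix (Fin 2) (Fin 2) ℤ) z - w) =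
        ((ε ^ 2 : ℝ) : ℂ) * ((z - w') / (z - w)) := by
    have hzw := hne w hz
    rw [hw, hw']
    generalize ((g 1 0 : ℤ) : ℂ) * z + (g 1 1 : ℤ) = j at hden ⊢
    push_cast
    field_simp
  rw [cycInt_one_eq w w' hz hgz, hratio,
    Complex.log_ofReal_mul (by positivity) (div_ne_zero (hne w' hz) (hne w hz)),
    Real.log_pow, add_sub_cancel_right]
  norm_num
end
end
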